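/- Let G be a connected simple graph of order n ≥ 3 and let k be a positive integer with k ≤ n−1 and k ≤ λ(G). If X and Y are adjacent vertices of the k-token graph F_k(G), then F_k(G) contains k(λ(G)−k+1) pairwise edge-disjoint X–Y paths. -/

import Mathlib

open Finset SimpleGraph

open scoped Classical

variable {V : Type*}

/-- The `k`-token graph of `G`: vertices are the `k`-subsets of `V(G)`, two of them
adjacent iff their symmetric difference is a pair of adjacent vertices of `G`. -/
def tokenGraph [DecidableEq V] (G : SimpleGraph V) (k : ℕ) :
    SimpleGraph {s : Finset V // s.card = k} :=
  SimpleGraph.fromRel fun A B => ∃ a b, G.Adj a b ∧ symmDiff A.1 B.1 = {a, b}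

/-- `G` is `t`-edge-connected: removing fewer than `t` edges leaves it connected. -/
def EdgeConnected (G : SimpleGraph V) (t : ℕ) : Prop :=
  ∀ F : Finset (Sym2 V), F.card < t → (G.deleteEdges (F : Set (Sym2 V))).Connected

/-- Edge-connectivity `λ(G)`. -/
noncomputable def edgeConn (G : SimpleGraph V) : ℕ :=
  sSup {t | EdgeConnected G t}

/-- `G` is `t`-vertex-connected. -/
def VertexConnected [Fintype V] (G : SimpleGraph V) (t : ℕ) : Prop :=
  t < Fintype.card V ∧
    ∀ S : Finset V, S.card < t → (G.induce ((↑(Sᶜ) : Set V))).Connected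

/-- Vertex-connectivity `κ(G)`. -/
noncomputable def vertexConn [Fintype V] (G : SimpleGraph V) : ℕ :=
  sSup {t | VertexConnected G t}

section menger
variable [Fintype V] [DecidableEq V]

/-- integral unit-capacity flow from `x` to `y` of value `m` supported on `H`. -/
structure UFlow (H : SimpleGraph V) (x y : V) (m : ℤ) (f : V → V → ℤ) : Prop where
  anti : ∀ a b, f b a = - f a b
  le_one : ∀ a b, f a b ≤ 1
  supp : ∀ a b, ¬ H.Adj a b → f a b = 0
  div : ∀ a, ∑ b, f a b = m * ((if a = x then 1 else 0) - (if a = y then 1 else 0))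

/-- net number of traversals of a dart by a walk -/
noncomputable def wflow {H : SimpleGraph V} : ∀ {u v : V}, H.Walk u v → V → V → ℤ
  | _, _, .nil, _, _ => 0
  | u, _, .cons (v := v) _ p, a, b =>
      (if a = u ∧ b = v then 1 else 0) - (if b = u ∧ a = v then 1 else 0) + wflow p a b

theorem wflow_anti {H : SimpleGraph V} {u v : V} (p : H.Walk u v) (a b : V) :
    wflow p b a = - wflow p a b := by
  induction p with
  | nil => simp [wflow]
  | cons h p ih => simp only [wflow, ih]; ring

theorem wflow_div {H : SimpleGraph V} {u v : V} (p : H.Walk u v) (a : V) :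
    ∑ b, wflow p a b = (if a = u then 1 else 0) - (if a = v then 1 else 0) := by
  induction p with
  | nil => simp [wflow]
  | cons h p ih =>
    simp only [wflow, Finset.sum_add_distrib, Finset.sum_sub_distrib, ih]
    simp [ite_and, Finset.sum_ite_eq']

theorem wflow_zero {H : SimpleGraph V} {u v : V} (p : H.Walk u v) (a b : V)
    (h : s(a, b) ∉ p.edges) : wflow p a b = 0 := by
  induction p with
  | nil => simp [wflow]
  | cons h' p ih =>
    simp only [Walk.edges_cons, List.mem_cons, not_or] at h
    simp only [wflow, ih h.2]
    have h1 := h.1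
    simp only [Sym2.eq_iff, not_or] at h1
    have h2 := h1.2
    simp [h1.1, and_comm (a := b = _), h2]

/-- for a path the net flow on a used dart is one -/
theorem wflow_one {H : SimpleGraph V} {u v : V} (p : H.Walk u v) (hp : p.IsPath) (a b : V)
    (h : s(a, b) ∈ p.edges) :
    (wflow p a b = 1 ∧ ∃ d ∈ p.darts, d.fst = a ∧ d.snd = b) ∨
    (wflow p a b = -1 ∧ ∃ d ∈ p.darts, d.fst = b ∧ d.snd = a) := by
  induction p with
  | nil => simp at h
  | @cons u w v h' p ih =>
    have ht := hp.isTrail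
    rw [Walk.isTrail_cons] at ht
    rw [Walk.cons_isPath_iff] at hp
    have hne : u ≠ w := h'.ne
    by_cases he : s(a, b) = s(u, w)
    · have hz : wflow p a b = 0 := wflow_zero p a b (he ▸ ht.2)
      simp only [wflow, hz]
      rcases Sym2.eq_iff.1 he with ⟨rfl, rfl⟩ | ⟨rfl, rfl⟩
      · left; refine ⟨by simp [hne, hne.symm], ⟨(a, b), h'⟩, by simp, rfl, rfl⟩
      · right; refine ⟨by simp [hne, hne.symm], ⟨(b, a), h'⟩, by simp, rfl, rfl⟩
    · have h2 : s(a, b) ∈ p.edges := by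
        simp only [Walk.edges_cons, List.mem_cons] at h
        tauto
      have he' := he
      simp only [Sym2.eq_iff, not_or] at he'
      have e1 : wflow (Walk.cons h' p) a b = wflow p a b := by
        have := he'.2
        simp [wflow, he'.1, and_comm (a := b = _), this]
      rw [e1]
      rcases ih hp.1 h2 with ⟨h3, d, hd, h4⟩ | ⟨h3, d, hd, h4⟩
      · exact Or.inl ⟨h3, d, by simp [hd], h4⟩
      · exact Or.inr ⟨h3, d, by simp [hd], h4⟩

/-- the flow out of a set containing `x` but not `y`. -/
theorem UFlow.cut {H : SimpleGraph V} {x y : V} {m : ℤ} {f : V → V → ℤ}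
    (hf : UFlow H x y m f) (A : Finset V) (hx : x ∈ A) (hy : y ∉ A) :
    ∑ a ∈ A, ∑ b ∈ Aᶜ, f a b = m := by
  have h1 : ∑ a ∈ A, ∑ b, f a b = m := by
    simp only [hf.div, ← Finset.mul_sum, Finset.sum_sub_distrib]
    simp [hx, hy]
  have h2 : ∑ a ∈ A, ∑ b ∈ A, f a b = 0 := by
    have : ∑ a ∈ A, ∑ b ∈ A, f a b = - ∑ a ∈ A, ∑ b ∈ A, f a b := by
      conv_lhs => rw [Finset.sum_comm]
      simp only [← Finset.sum_neg_distrib]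
      exact Finset.sum_congr rfl fun a _ => Finset.sum_congr rfl fun b _ => hf.anti a b
    linarith
  rw [← h1, ← zero_add (∑ a ∈ A, ∑ b ∈ Aᶜ, f a b), ← h2, ← Finset.sum_add_distrib]
  exact Finset.sum_congr rfl fun a _ => Finset.sum_add_sum_compl A _

/-- either reach `y` through darts satisfying `Q`, or there is a closed cut -/
theorem reach_or_cut (H : SimpleGraph V) (x y : V) (Q : V → V → Prop) :
    (∃ p : H.Walk x y, p.IsPath ∧ ∀ d ∈ p.darts, Q d.fst d.snd) ∨
    ∃ A : Finset V, x ∈ A ∧ y ∉ A ∧ ∀ a ∈ A, ∀ b ∉ A, H.Adj a b → ¬ Q a b := by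
  by_cases h : ∃ p : H.Walk x y, ∀ d ∈ p.darts, Q d.fst d.snd
  · obtain ⟨p, hp⟩ := h
    exact Or.inl ⟨p.bypass, p.bypass_isPath, fun d hd => hp d (p.darts_bypass_subset_darts hd)⟩
  · right
    refine ⟨Finset.univ.filter fun v => ∃ p : H.Walk x v, ∀ d ∈ p.darts, Q d.fst d.snd,
      ?_, ?_, ?_⟩
    · simp only [Finset.mem_filter, Finset.mem_univ, true_and]
      exact ⟨Walk.nil, by simp⟩
    · simpa using h
    · intro a ha b hb hab hQ
      simp only [Finset.mem_filter, Finset.mem_univ, true_and] at ha hb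
      obtain ⟨p, hp⟩ := ha
      refine hb ⟨p.concat hab, fun d hd => ?_⟩
      rw [Walk.darts_concat] at hd
      simp only [List.concat_eq_append, List.mem_append, List.mem_singleton] at hd
      rcases hd with hd | rfl
      · exact hp d hd
      · exact hQ

theorem exists_flow (H : SimpleGraph V) (x y : V) (t : ℕ)
    (hcut : ∀ A : Finset V, x ∈ A → y ∉ A →
      t ≤ ((A ×ˢ Aᶜ).filter fun q => H.Adj q.1 q.2).card) :
    ∀ m : ℕ, m ≤ t → ∃ f, UFlow H x y m f := by
  intro m
  induction m with
  | zero => intro _; exact ⟨fun _ _ => 0, by simp, by simp, by simp, by simp⟩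
  | succ m ih =>
    intro hm
    obtain ⟨f, hf⟩ := ih (by omega)
    rcases reach_or_cut H x y (fun a b => f a b < 1) with ⟨p, hp, hQ⟩ | ⟨A, hx, hy, hA⟩
    · refine ⟨fun a b => f a b + wflow p a b, ?_, ?_, ?_, ?_⟩
      · intro a b; simp only [hf.anti a b, wflow_anti p a b]; ring
      · intro a b
        by_cases he : s(a, b) ∈ p.edges
        · rcases wflow_one p hp a b he with ⟨h1, d, hd, rfl, rfl⟩ | ⟨h1, _⟩
          · have := hQ d hd; simp only [h1]; omega
          · have := hf.le_one a b; simp only [h1]; omega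
        · simp only [wflow_zero p a b he, add_zero]; exact hf.le_one a b
      · intro a b hab
        simp only [hf.supp a b hab, wflow_zero p a b (fun he => hab (p.adj_of_mem_edges he)),
          add_zero]
      · intro a
        simp only [Finset.sum_add_distrib, hf.div, wflow_div]; push_cast; ring
    · exfalso
      have h1 := hf.cut A hx hy
      have h2 := hcut A hx hy
      have h3 : ∑ a ∈ A, ∑ b ∈ Aᶜ, f a b =
          (((A ×ˢ Aᶜ).filter fun q => H.Adj q.1 q.2).card : ℤ) := by
        rw [Finset.card_filter, Nat.cast_sum, Finset.sum_product]
        refine Finset.sum_congr rfl fun a ha => Finset.sum_congr rfl fun b hb => ?_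
        by_cases hab : H.Adj a b
        · have := hA a ha b (by simpa using hb) hab
          have := hf.le_one a b
          simp only [hab, if_true]; push_cast; omega
        · simp [hab, hf.supp a b hab]
      rw [h1] at h3
      have : m = _ := Nat.cast_injective (R := ℤ) h3
      omega

theorem flow_decomp (H : SimpleGraph V) (x y : V) (t : ℕ) :
    ∀ f, UFlow H x y t f → ∃ P : Fin t → H.Walk x y,
      (∀ i, ∀ a b, s(a, b) ∈ (P i).edges → f a b ≠ 0) ∧
      ∀ i j, i ≠ j → ∀ e, e ∈ (P i).edges → e ∉ (P j).edges := by
  induction t with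
  | zero => intro f _; exact ⟨fun i => i.elim0, fun i => i.elim0, fun i => i.elim0⟩
  | succ t ih =>
    intro f hf
    rcases reach_or_cut H x y (fun a b => f a b = 1) with ⟨p, hp, hQ⟩ | ⟨A, hx, hy, hA⟩
    · have key : ∀ a b, s(a, b) ∈ p.edges → f a b = wflow p a b ∧ f a b ≠ 0 := by
        intro a b he
        rcases wflow_one p hp a b he with ⟨h1, d, hd, rfl, rfl⟩ | ⟨h1, d, hd, rfl, rfl⟩
        · have := hQ d hd; omega
        · have := hQ d hd
          have := hf.anti d.fst d.snd; omega
      obtain ⟨P, hP1, hP2⟩ := ih (fun a b => f a b - wflow p a b) (by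
        refine ⟨?_, ?_, ?_, ?_⟩
        · intro a b; simp only [hf.anti a b, wflow_anti p a b]; ring
        · intro a b
          by_cases he : s(a, b) ∈ p.edges
          · have := (key a b he).1; simp only [this]; omega
          · simp only [wflow_zero p a b he, sub_zero]; exact hf.le_one a b
        · intro a b hab
          simp only [hf.supp a b hab, wflow_zero p a b (fun he => hab (p.adj_of_mem_edges he)),
            sub_zero]
        · intro a
          simp only [Finset.sum_sub_distrib, hf.div, wflow_div]; push_cast; ring)
      have hdis : ∀ i, ∀ e, e ∈ (P i).edges → e ∉ p.edges := by
        intro i e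
        induction e with
        | h a b =>
          intro h1 h2
          exact hP1 i a b h1 (by simp only [(key a b h2).1]; omega)
      refine ⟨Fin.cons p P, ?_, ?_⟩
      · intro i
        refine Fin.cases ?_ (fun i => ?_) i
        · intro a b he; exact (key a b (by simpa using he)).2
        · intro a b he
          simp only [Fin.cons_succ] at he
          have h1 := hP1 i a b he
          rw [wflow_zero p a b (hdis i _ he)] at h1
          simpa using h1
      · intro i j
        refine Fin.cases ?_ (fun i => ?_) i <;> refine Fin.cases ?_ (fun j => ?_) j
        · simp
        · intro _ e h1 h2; simp only [Fin.cons_succ, Fin.cons_zero] at h1 h2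
          exact hdis j e h2 h1
        · intro _ e h1 h2; simp only [Fin.cons_succ, Fin.cons_zero] at h1 h2
          exact hdis i e h1 h2
        · intro hij e h1
          simp only [Fin.cons_succ] at h1 ⊢
          exact hP2 i j (fun h => hij (by rw [h])) e h1
    · exfalso
      have h1 := hf.cut A hx hy
      have h2 : ∑ a ∈ A, ∑ b ∈ Aᶜ, f a b ≤ 0 := by
        refine Finset.sum_nonpos fun a ha => Finset.sum_nonpos fun b hb => ?_
        by_cases hab : H.Adj a b
        · have := hA a ha b (by simpa using hb) hab
          have := hf.le_one a b
          omega
        · simp [hf.supp a b hab]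
      push_cast at h1; omega

/-- edge version of Menger's theorem -/
theorem edge_menger (H : SimpleGraph V) (x y : V) (t : ℕ)
    (hcut : ∀ A : Finset V, x ∈ A → y ∉ A →
      t ≤ ((A ×ˢ Aᶜ).filter fun q => H.Adj q.1 q.2).card) :
    ∃ P : Fin t → H.Walk x y,
      ∀ i j, i ≠ j → ∀ e, e ∈ (P i).edges → e ∉ (P j).edges := by
  obtain ⟨f, hf⟩ := exists_flow H x y t hcut t le_rfl
  obtain ⟨P, _, h⟩ := flow_decomp H x y t f hf
  exact ⟨P, h⟩

theorem cut_of_edgeConn (G : SimpleGraph V) (t : ℕ) (ht : EdgeConnected G t) (A : Finset V)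
    (x y : V) (hx : x ∈ A) (hy : y ∉ A) :
    t ≤ ((A ×ˢ Aᶜ).filter fun q => G.Adj q.1 q.2).card := by
  by_contra hlt
  push Not at hlt
  set C := (A ×ˢ Aᶜ).filter fun q => G.Adj q.1 q.2
  have hc := ht (C.image fun q => s(q.1, q.2)) (lt_of_le_of_lt Finset.card_image_le hlt)
  rcases reach_or_cut (G.deleteEdges ((C.image fun q => s(q.1, q.2) : Finset (Sym2 V)) :
    Set (Sym2 V))) x y (fun a b => ¬ (a ∈ A ∧ b ∉ A)) with ⟨p, _, hp⟩ | ⟨B, hxB, hyB, hB⟩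
  · have : ∀ (u v : V) (q : (G.deleteEdges ((C.image fun q => s(q.1, q.2) : Finset (Sym2 V)) :
        Set (Sym2 V))).Walk u v), (∀ d ∈ q.darts, ¬ (d.fst ∈ A ∧ d.snd ∉ A)) → u ∈ A → v ∈ A := by
      intro u v q
      induction q with
      | nil => intro _ h; exact h
      | cons h q ih =>
        intro hd hu
        simp only [Walk.darts_cons, List.mem_cons, forall_eq_or_imp] at hd
        exact ih hd.2 (by by_contra h'; exact hd.1 ⟨hu, h'⟩)
    exact hy (this x y p hp hx)
  · obtain ⟨p⟩ := hc.preconnected x y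
    have : ∀ (u v : V) (q : (G.deleteEdges ((C.image fun q => s(q.1, q.2) : Finset (Sym2 V)) :
        Set (Sym2 V))).Walk u v), u ∈ B → v ∈ B := by
      intro u v q
      induction q with
      | nil => intro h; exact h
      | cons h q ih =>
        intro hu
        apply ih
        by_contra hv
        have h1 := hB _ hu _ hv h
        simp only [not_not] at h1
        rw [deleteEdges_adj] at h
        apply h.2
        simp only [Finset.coe_image, Set.mem_image, Finset.mem_coe]
        exact ⟨(_, _), by simp [C, h1, h.1], rfl⟩
    exact hyB (this x y p hxB)

theorem edgeConnected_edgeConn (G : SimpleGraph V) (h3 : 2 ≤ Fintype.card V) :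
    EdgeConnected G (edgeConn G) := by
  have hb : BddAbove {t | EdgeConnected G t} := by
    refine ⟨(Finset.univ : Finset (Sym2 V)).card, fun t ht => ?_⟩
    by_contra hlt
    have hc := ht Finset.univ (by omega)
    obtain ⟨a, b, hab⟩ := Fintype.one_lt_card_iff.1 (show 1 < Fintype.card V by omega)
    obtain ⟨p⟩ := hc.preconnected a b
    cases p with
    | nil => exact hab rfl
    | cons h _ => simp [deleteEdges_adj] at h
  exact Nat.sSup_mem (s := {t | EdgeConnected G t}) ⟨0, fun F hF => by omega⟩ hb

end menger

section tokens
variable [DecidableEq V]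

/-- One token move along an edge of `G`, the used edge of the token graph lying in `E`. -/
def Stp (G : SimpleGraph V) (E : Set (Sym2 (Finset V))) (A B : Finset V) : Prop :=
  ∃ a b, G.Adj a b ∧ a ∈ A ∧ b ∉ A ∧ B = insert b (A.erase a) ∧ s(A, B) ∈ E

theorem symmDiff_move (A : Finset V) (a b : V) (ha : a ∈ A) (hb : b ∉ A) :
    symmDiff A (insert b (A.erase a)) = {a, b} := by
  have : a ≠ b := fun h => hb (h ▸ ha)
  ext t
  simp only [Finset.mem_symmDiff, Finset.mem_insert, Finset.mem_erase, Finset.mem_singleton]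
  grind

theorem card_move (A : Finset V) (a b : V) (ha : a ∈ A) (hb : b ∉ A) :
    (insert b (A.erase a)).card = A.card := by
  rw [Finset.card_insert_of_notMem (by simp [hb]), Finset.card_erase_add_one ha]

theorem token_adj (G : SimpleGraph V) (k : ℕ) (A B : {s : Finset V // s.card = k}) (a b : V)
    (hab : G.Adj a b) (ha : a ∈ A.1) (hb : b ∉ A.1) (h : B.1 = insert b (A.1.erase a)) :
    (tokenGraph G k).Adj A B := by
  rw [tokenGraph, SimpleGraph.fromRel_adj]
  refine ⟨fun h' => ?_, Or.inl ⟨a, b, hab, ?_⟩⟩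
  · apply hb; rw [h', h]; simp
  · rw [h]; exact symmDiff_move _ _ _ ha hb

theorem reach_walk (G : SimpleGraph V) (k : ℕ) (E : Set (Sym2 (Finset V))) (A B : Finset V)
    (h : Relation.ReflTransGen (Stp G E) A B) (hA : A.card = k) :
    ∃ hB : B.card = k, ∃ w : (tokenGraph G k).Walk ⟨A, hA⟩ ⟨B, hB⟩,
      ∀ e ∈ w.edges, e.map Subtype.val ∈ E := by
  induction h with
  | refl => exact ⟨hA, Walk.nil, by simp⟩
  | tail _ hs ih =>
    obtain ⟨hB, w, hw⟩ := ih
    obtain ⟨a, b, hab, ha, hb, rfl, hE⟩ := hs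
    refine ⟨by rw [card_move _ _ _ ha hb, hB],
      w.concat (token_adj G k _ _ a b hab ha hb rfl), ?_⟩
    intro e he
    rw [Walk.edges_concat] at he
    simp only [List.concat_eq_append, List.mem_append, List.mem_singleton] at he
    rcases he with he | rfl
    · exact hw e he
    · simpa using hE

/-- label of an edge of the token graph: the pair of vertices involved in the move -/
def lab : Sym2 (Finset V) → Finset V :=
  Sym2.lift ⟨fun A B => symmDiff A B, fun A B => symmDiff_comm A B⟩

@[simp] theorem lab_mk (A B : Finset V) : lab s(A, B) = symmDiff A B := rfl

/-- Edges allowed for the translation of a walk of `G` with edge set `S`. -/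
def EP (X Y Z : Finset V) (S : Set (Sym2 V)) : Set (Sym2 (Finset V)) :=
  {e | (∃ f ∈ S, lab e = f.toFinset) ∧ (X ∈ e ∨ Y ∈ e → Disjoint (lab e) Z)}

theorem stp_EP (G : SimpleGraph V) (X Y Z : Finset V) (S : Set (Sym2 V)) (A B : Finset V)
    (a b : V) (hab : G.Adj a b) (ha : a ∈ A) (hb : b ∉ A) (hB : B = insert b (A.erase a))
    (hS : s(a, b) ∈ S) (hd : (a ∉ Z ∧ b ∉ Z) ∨ (A ≠ X ∧ A ≠ Y ∧ B ≠ X ∧ B ≠ Y)) :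
    Stp G (EP X Y Z S) A B := by
  refine ⟨a, b, hab, ha, hb, hB, ⟨s(a, b), hS, ?_⟩, ?_⟩
  · rw [lab_mk, hB, symmDiff_move _ _ _ ha hb]
    ext t; simp
  · rw [lab_mk, hB, symmDiff_move _ _ _ ha hb, ← hB]
    intro h
    rcases hd with hd | hd
    · simp [hd.1, hd.2]
    · simp only [Sym2.mem_iff] at h
      grind

theorem token_translate (G H : SimpleGraph V) (hH : H ≤ G) (Z : Finset V) (x y : V)
    (hx : x ∉ Z) (hy : y ∉ Z) (hxz : ∀ z ∈ Z, ¬ H.Adj x z) (hyz : ∀ z ∈ Z, ¬ H.Adj y z)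
    (S : Set (Sym2 V)) (v t : V) (p : H.Walk v t) (hp : ∀ e ∈ p.edges, e ∈ S) (ht : t = y) :
    (v ∉ Z → Relation.ReflTransGen (Stp G (EP (insert x Z) (insert y Z) Z S))
      (insert v Z) (insert y Z)) ∧
    (v ∈ Z → ∃ w, w ∉ Z ∧ w ≠ x ∧ w ≠ y ∧
      Relation.ReflTransGen (Stp G (EP (insert x Z) (insert y Z) Z S)) (insert w Z) (insert y Z) ∧
      ∀ u, u ∉ Z → u ≠ x → u ≠ y → u ≠ w →
        Relation.ReflTransGen (Stp G (EP (insert x Z) (insert y Z) Z S)) (insert u Z)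
          (insert w (insert u (Z.erase v)))) := by
  induction p with
  | nil => subst ht; exact ⟨fun _ => .refl, fun h => absurd h hy⟩
  | @cons v v' t h p ih =>
    simp only [Walk.edges_cons, List.mem_cons, forall_eq_or_imp] at hp
    obtain ⟨hvS, hpS⟩ := hp
    obtain ⟨ih1, ih2⟩ := ih hpS ht
    have hne : v ≠ v' := h.ne
    have hA : ∀ c, c ∉ Z → c ≠ x → c ≠ y → ∀ W : Finset V,
        c ∈ W → W ≠ insert x Z ∧ W ≠ insert y Z := by
      intro c hc hcx hcy W hW
      constructor <;> (rintro rfl; simp [hc, hcx, hcy] at hW)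
    by_cases hv : v ∈ Z <;> by_cases hv' : v' ∈ Z
    · refine ⟨fun h' => absurd hv h', fun _ => ?_⟩
      obtain ⟨w, hw, hwx, hwy, hr, hu⟩ := ih2 hv'
      refine ⟨w, hw, hwx, hwy, hr, fun u hu1 hux huy huw => ?_⟩
      refine (hu u hu1 hux huy huw).tail ?_
      have h1 := hA u hu1 hux huy (insert w (insert u (Z.erase v'))) (by simp)
      have h2 := hA u hu1 hux huy (insert w (insert u (Z.erase v))) (by simp)
      refine stp_EP G _ _ _ _ _ _ v v' (hH h) ?_ ?_ ?_ hvS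
        (Or.inr ⟨h1.1, h1.2, h2.1, h2.2⟩)
      · simp [hv, hne]
      · simp only [Finset.mem_insert, Finset.mem_erase]; grind
      · ext t; simp only [Finset.mem_insert, Finset.mem_erase]; grind
    · refine ⟨fun h' => absurd hv h', fun _ => ?_⟩
      have hvx : v' ≠ x := by rintro rfl; exact hxz v hv h.symm
      have hvy : v' ≠ y := by rintro rfl; exact hyz v hv h.symm
      refine ⟨v', hv', hvx, hvy, ih1 hv', fun u hu1 hux huy huw => ?_⟩
      refine .single ?_
      have h1 := hA u hu1 hux huy (insert u Z) (by simp)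
      have h2 := hA u hu1 hux huy (insert v' (insert u (Z.erase v))) (by simp)
      refine stp_EP G _ _ _ _ _ _ v v' (hH h) ?_ ?_ ?_ hvS
        (Or.inr ⟨h1.1, h1.2, h2.1, h2.2⟩)
      · simp [hv]
      · simp only [Finset.mem_insert]; grind
      · ext t; simp only [Finset.mem_insert, Finset.mem_erase]; grind
    · refine ⟨fun _ => ?_, fun h' => absurd h' hv⟩
      have hvx : v ≠ x := by rintro rfl; exact hxz v' hv' h
      have hvy : v ≠ y := by rintro rfl; exact hyz v' hv' h
      obtain ⟨w, hw, hwx, hwy, hr, hu⟩ := ih2 hv'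
      by_cases hvw : v = w
      · subst hvw; exact hr
      · refine ((hu v hv hvx hvy hvw).tail ?_).trans hr
        have h1 := hA w hw hwx hwy (insert w (insert v (Z.erase v'))) (by simp)
        have h2 := hA w hw hwx hwy (insert w Z) (by simp)
        refine stp_EP G _ _ _ _ _ _ v v' (hH h) ?_ ?_ ?_ hvS
          (Or.inr ⟨h1.1, h1.2, h2.1, h2.2⟩)
        · simp
        · simp only [Finset.mem_insert, Finset.mem_erase]; grind
        · ext t; simp only [Finset.mem_insert, Finset.mem_erase]; grind
    · refine ⟨fun _ => ?_, fun h' => absurd h' hv⟩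
      refine .head ?_ (ih1 hv')
      refine stp_EP G _ _ _ _ _ _ v v' (hH h) ?_ ?_ ?_ hvS (Or.inl ⟨hv, hv'⟩)
      · simp
      · simp only [Finset.mem_insert]; grind
      · ext t; simp only [Finset.mem_insert, Finset.mem_erase]; grind

end tokens

section core
variable [Fintype V] [DecidableEq V]

theorem token_split (G : SimpleGraph V) (k : ℕ) (X Y : {s : Finset V // s.card = k})
    (h : (tokenGraph G k).Adj X Y) :
    ∃ (Z : Finset V) (x y : V), x ∉ Z ∧ y ∉ Z ∧ G.Adj x y ∧ X.1 = insert x Z ∧ Y.1 = insert y Z := by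
  obtain ⟨X, hX⟩ := X
  obtain ⟨Y, hY⟩ := Y
  have h0 : ∃ a b, G.Adj a b ∧ symmDiff X Y = {a, b} := by
    rw [tokenGraph, SimpleGraph.fromRel_adj] at h
    rcases h.2 with h | ⟨a, b, hab, h⟩
    · exact h
    · exact ⟨a, b, hab, by rw [symmDiff_comm]; exact h⟩
  obtain ⟨a, b, hab, hs⟩ := h0
  have hne := hab.ne
  have hm : ∀ t, (t ∈ X ∧ t ∉ Y ∨ t ∈ Y ∧ t ∉ X) ↔ t = a ∨ t = b := by
    intro t
    have := Finset.ext_iff.1 hs t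
    simpa [Finset.mem_symmDiff] using this
  have ha := (hm a).2 (Or.inl rfl)
  have hb := (hm b).2 (Or.inr rfl)
  have no1 : ∀ X Y : Finset V, X.card = k → Y.card = k →
      (∀ t, (t ∈ X ∧ t ∉ Y ∨ t ∈ Y ∧ t ∉ X) ↔ t = a ∨ t = b) →
      a ∈ X → b ∈ X → a ∉ Y → b ∉ Y → False := by
    intro X Y hX hY hm haX hbX haY hbY
    have hsub : Y ⊂ X := by
      rw [Finset.ssubset_iff_of_subset]
      · exact ⟨a, haX, haY⟩
      · intro t ht
        by_contra htX
        rcases (hm t).1 (Or.inr ⟨ht, htX⟩) with rfl | rfl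
        · exact haY ht
        · exact hbY ht
    have := Finset.card_lt_card hsub
    omega
  have fin : ∀ x y, x ∈ X → x ∉ Y → y ∈ Y → y ∉ X → G.Adj x y →
      (∀ t, (t ∈ X ∧ t ∉ Y ∨ t ∈ Y ∧ t ∉ X) ↔ t = x ∨ t = y) →
      ∃ (Z : Finset V) (x y : V), x ∉ Z ∧ y ∉ Z ∧ G.Adj x y ∧ X = insert x Z ∧ Y = insert y Z := by
    intro x y hx hx' hy hy' hxy hm
    refine ⟨X ∩ Y, x, y, by simp [hx'], by simp [hy'], hxy, ?_, ?_⟩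
    · ext t; have := hm t
      simp only [Finset.mem_insert, Finset.mem_inter]; grind
    · ext t; have := hm t
      simp only [Finset.mem_insert, Finset.mem_inter]; grind
  rcases ha with ⟨h1, h2⟩ | ⟨h1, h2⟩ <;> rcases hb with ⟨h3, h4⟩ | ⟨h3, h4⟩
  · exact (no1 X Y hX hY hm h1 h3 h2 h4).elim
  · exact fin a b h1 h2 h3 h4 hab hm
  · exact fin b a h3 h4 h1 h2 hab.symm (fun t => (hm t).trans or_comm)
  · exact (no1 Y X hY hX (fun t => or_comm.trans (hm t)) h1 h3 h2 h4).elim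

/-- `G` without the edges joining `x, y` to `Z ∪ {x, y}`. -/
def cutGraph (G : SimpleGraph V) (Z : Finset V) (x y : V) : SimpleGraph V where
  Adj a b := G.Adj a b ∧ ¬ ((a = x ∨ a = y) ∧ (b = x ∨ b = y ∨ b ∈ Z)) ∧
    ¬ ((b = x ∨ b = y) ∧ (a = x ∨ a = y ∨ a ∈ Z))
  symm := ⟨fun _ _ h => ⟨h.1.symm, h.2.2, h.2.1⟩⟩
  loopless := ⟨fun a h => G.loopless.irrefl a h.1⟩

theorem cutGraph_paths (G : SimpleGraph V) (l : ℕ) (hl : EdgeConnected G l) (Z : Finset V)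
    (x y : V) :
    ∃ P : Fin (l - 1 - (Z.filter fun z => G.Adj x z ∨ G.Adj z y).card) →
      (cutGraph G Z x y).Walk x y,
      ∀ i j, i ≠ j → ∀ e, e ∈ (P i).edges → e ∉ (P j).edges := by
  apply edge_menger
  intro A hx hy
  have h1 := cut_of_edgeConn G l hl A x y hx hy
  set Zh := Z.filter fun z => G.Adj x z ∨ G.Adj z y
  have hsub : ((A ×ˢ Aᶜ).filter fun q => G.Adj q.1 q.2) ⊆
      ((A ×ˢ Aᶜ).filter fun q => (cutGraph G Z x y).Adj q.1 q.2) ∪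
      insert (x, y) (Zh.image fun z => if z ∈ A then (z, y) else (x, z)) := by
    rintro ⟨a, b⟩ hq
    simp only [Finset.mem_filter, Finset.mem_product, Finset.mem_compl] at hq
    obtain ⟨⟨ha, hb⟩, hab⟩ := hq
    simp only [Finset.mem_union, Finset.mem_filter, Finset.mem_product, Finset.mem_compl,
      Finset.mem_insert, Finset.mem_image, Prod.mk.injEq]
    have hay : a ≠ y := by rintro rfl; exact hy ha
    have hbx : b ≠ x := by rintro rfl; exact hb hx
    by_cases hH : (cutGraph G Z x y).Adj a b
    · exact Or.inl ⟨⟨ha, hb⟩, hH⟩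
    · right
      have hH' : ((a = x ∨ a = y) ∧ (b = x ∨ b = y ∨ b ∈ Z)) ∨
          ((b = x ∨ b = y) ∧ (a = x ∨ a = y ∨ a ∈ Z)) := by
        by_contra hc
        exact hH ⟨hab, fun h => hc (Or.inl h), fun h => hc (Or.inr h)⟩
      rcases hH' with ⟨h1, h2⟩ | ⟨h1, h2⟩
      · have hax : a = x := by tauto
        subst hax
        rcases h2 with h2 | h2 | h2
        · exact absurd h2 hbx
        · exact Or.inl ⟨rfl, h2⟩
        · exact Or.inr ⟨b, by simp [Zh, h2, hab], by simp [hb]⟩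
      · have hby : b = y := by tauto
        subst hby
        rcases h2 with h2 | h2 | h2
        · exact Or.inl ⟨h2, rfl⟩
        · exact absurd h2 hay
        · exact Or.inr ⟨a, by simp [Zh, h2, hab], by simp [ha]⟩
  have h2 := Finset.card_le_card hsub
  have h3 := Finset.card_union_le ((A ×ˢ Aᶜ).filter fun q => (cutGraph G Z x y).Adj q.1 q.2)
    (insert (x, y) (Zh.image fun z => if z ∈ A then (z, y) else (x, z)))
  have h4 := Finset.card_insert_le (x, y) (Zh.image fun z => if z ∈ A then (z, y) else (x, z))
  have h5 := Finset.card_image_le (s := Zh) (f := fun z => if z ∈ A then (z, y) else (x, z))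
  omega

/-- neighbours of `z` outside `Z ∪ {x, y}` -/
noncomputable def outN (G : SimpleGraph V) (Z : Finset V) (x y z : V) : Finset V :=
  Finset.univ.filter fun w => G.Adj z w ∧ w ∉ Z ∧ w ≠ x ∧ w ≠ y

theorem outN_card (G : SimpleGraph V) (l : ℕ) (hl : EdgeConnected G l) (Z : Finset V)
    (x y z : V) (hz : z ∈ Z) (hx : x ∉ Z) :
    l ≤ (outN G Z x y z).card + (if G.Adj x z ∨ G.Adj z y then 1 else 0) +
      (if G.Adj x z ∧ G.Adj z y then 1 else 0) + (Z.card - 1) := by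
  have hxz : x ≠ z := by rintro rfl; exact hx hz
  have h1 := cut_of_edgeConn G l hl {z} z x (by simp) (by simpa using hxz)
  have h2 : ((({z} : Finset V) ×ˢ ({z} : Finset V)ᶜ).filter fun q => G.Adj q.1 q.2).card ≤
      ((outN G Z x y z ∪ Z.erase z) ∪
        (({x} : Finset V).filter (fun v => G.Adj v z) ∪
          ({y} : Finset V).filter fun v => G.Adj z v)).card := by
    refine Finset.card_le_card_of_injOn (fun q => q.2) ?_ ?_
    · rintro ⟨a, b⟩ hq
      simp only [Finset.coe_filter, Finset.mem_product, Finset.mem_singleton, Finset.mem_compl,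
        Set.mem_ofPred_eq] at hq
      obtain ⟨⟨rfl, hb⟩, hab⟩ := hq
      simp only [Finset.coe_union, Set.mem_union, Finset.mem_coe, outN, Finset.mem_filter,
        Finset.mem_univ, true_and, Finset.mem_erase, Finset.mem_singleton]
      have := hab.symm
      grind
    · rintro ⟨a, b⟩ hq ⟨a', b'⟩ hq' h
      simp only [Finset.coe_filter, Finset.mem_product, Finset.mem_singleton, Finset.mem_compl,
        Set.mem_ofPred_eq] at hq hq'
      simp only [Prod.mk.injEq]
      exact ⟨hq.1.1.trans hq'.1.1.symm, h⟩
  have h3 := Finset.card_union_le (outN G Z x y z ∪ Z.erase z)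
    (({x} : Finset V).filter (fun v => G.Adj v z) ∪ ({y} : Finset V).filter fun v => G.Adj z v)
  have h4 := Finset.card_union_le (outN G Z x y z) (Z.erase z)
  have h5 := Finset.card_union_le (({x} : Finset V).filter (fun v => G.Adj v z))
    (({y} : Finset V).filter fun v => G.Adj z v)
  rw [Finset.card_erase_of_mem hz] at h4
  rw [Finset.filter_singleton, Finset.filter_singleton] at h5
  rw [Finset.filter_singleton, Finset.filter_singleton] at h3 h2
  by_cases e1 : G.Adj x z <;> by_cases e2 : G.Adj z y <;>
    simp only [e1, e2, if_true, if_false, Finset.card_singleton, Finset.card_empty, true_or,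
      or_true, and_true, true_and, or_false, false_or, and_false, false_and, and_self, or_self]
      at h2 h3 h5 ⊢ <;> omega

theorem count_le (G : SimpleGraph V) (l : ℕ) (hl : EdgeConnected G l) (Z : Finset V)
    (x y : V) (hx : x ∉ Z) (hk : Z.card + 1 ≤ l) :
    (Z.card + 1) * (l - (Z.card + 1) + 1) ≤
      1 + (Z.filter fun z => G.Adj x z ∧ G.Adj z y).card + ∑ z ∈ Z, (outN G Z x y z).card +
      (l - 1 - (Z.filter fun z => G.Adj x z ∨ G.Adj z y).card) := by
  have h1 := Finset.sum_le_sum fun z (hz : z ∈ Z) => outN_card G l hl Z x y z hz hx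
  simp only [Finset.sum_add_distrib, Finset.sum_const, smul_eq_mul, ← Finset.card_filter] at h1
  have h2 : (Z.filter fun z => G.Adj x z ∨ G.Adj z y).card ≤ Z.card := Finset.card_filter_le _ _
  generalize (Z.filter fun z => G.Adj x z ∨ G.Adj z y).card = h at *
  generalize (Z.filter fun z => G.Adj x z ∧ G.Adj z y).card = c at *
  generalize ∑ z ∈ Z, (outN G Z x y z).card = B at *
  generalize Z.card = m at *
  obtain ⟨d, rfl⟩ := Nat.exists_eq_add_of_le hk
  have e1 : m + 1 + d - (m + 1) + 1 = d + 1 := by omega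
  rw [e1]
  rcases m with _ | m
  · omega
  · simp only [Nat.add_sub_cancel] at h1
    have e2 : (m + 1 + 1) * (d + 1) = m * d + 2 * d + m + 2 := by ring
    have e3 : (m + 1) * (m + 1 + 1 + d) = m * m + m * d + 3 * m + d + 2 := by ring
    have e4 : (m + 1) * m = m * m + m := by ring
    rw [e3, e4] at h1
    rw [e2]
    omega

/-- index set of the path system -/
abbrev Idx (G : SimpleGraph V) (Z : Finset V) (x y : V) (t : ℕ) : Type _ :=
  (Unit ⊕ {z // z ∈ Z.filter fun z => G.Adj x z ∧ G.Adj z y}) ⊕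
    ({q // q ∈ Z.sigma fun z => outN G Z x y z} ⊕ Fin t)

/-- sets of allowed token graph edges for each member of the path system -/
def EI (G : SimpleGraph V) (Z : Finset V) (x y : V) (t : ℕ)
    (P : Fin t → (cutGraph G Z x y).Walk x y) : Idx G Z x y t → Set (Sym2 (Finset V))
  | .inl (.inl _) => {s(insert x Z, insert y Z)}
  | .inl (.inr z) => {e | lab e = {z.1, y} ∨ lab e = {x, z.1}}
  | .inr (.inl q) => {e | (lab e = {q.1.1, q.1.2} ∧ (insert x Z ∈ e ∨ insert y Z ∈ e)) ∨
      e = s(insert q.1.2 ((insert x Z).erase q.1.1), insert q.1.2 ((insert y Z).erase q.1.1))}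
  | .inr (.inr i) => EP (insert x Z) (insert y Z) Z {f | f ∈ (P i).edges}

theorem pair_eq {a b c d : V} (h : ({a, b} : Finset V) = {c, d}) :
    (a = c ∨ a = d) ∧ (b = c ∨ b = d) ∧ (c = a ∨ c = b) ∧ (d = a ∨ d = b) := by
  have ha := Finset.ext_iff.1 h a
  have hb := Finset.ext_iff.1 h b
  have hc := Finset.ext_iff.1 h c
  have hd := Finset.ext_iff.1 h d
  simp only [Finset.mem_insert, Finset.mem_singleton] at ha hb hc hd
  exact ⟨ha.1 (Or.inl trivial), hb.1 (Or.inr trivial), hc.2 (Or.inl trivial), hd.2 (Or.inr trivial)⟩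

theorem lab_XY (Z : Finset V) (x y : V) (hx : x ∉ Z) (hy : y ∉ Z) (hxy : x ≠ y) :
    lab s(insert x Z, insert y Z) = {x, y} := by
  rw [lab_mk]; ext t
  simp only [Finset.mem_symmDiff, Finset.mem_insert, Finset.mem_singleton]; grind

theorem lab_mid (Z : Finset V) (x y z w : V) (hx : x ∉ Z) (hy : y ∉ Z) (hxy : x ≠ y)
    (hz : z ∈ Z) (hwx : w ≠ x) (hwy : w ≠ y) :
    lab s(insert w ((insert x Z).erase z), insert w ((insert y Z).erase z)) = {x, y} := by
  have : x ≠ z := by rintro rfl; exact hx hz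
  have : y ≠ z := by rintro rfl; exact hy hz
  rw [lab_mk]; ext t
  simp only [Finset.mem_symmDiff, Finset.mem_insert, Finset.mem_singleton, Finset.mem_erase]; grind

theorem EP_lab (G : SimpleGraph V) (Z X Y : Finset V) (x y : V) 
    (p : (cutGraph G Z x y).Walk x y) (e : Sym2 (Finset V))
    (he : e ∈ EP X Y Z {f | f ∈ p.edges}) (a b : V) (hab : lab e = {a, b}) :
    a = b ∨ (cutGraph G Z x y).Adj a b := by
  obtain ⟨⟨f, hf, hl⟩, _⟩ := he
  rw [hl] at hab
  have : f = s(a, b) := by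
    apply Sym2.ext; intro t
    have := Finset.ext_iff.1 hab t
    simpa using this
  subst this
  exact Or.inr (p.adj_of_mem_edges hf)

theorem EI_disj (G : SimpleGraph V) (Z : Finset V) (x y : V) (t : ℕ)
    (P : Fin t → (cutGraph G Z x y).Walk x y)
    (hP : ∀ i j, i ≠ j → ∀ e, e ∈ (P i).edges → e ∉ (P j).edges)
    (hx : x ∉ Z) (hy : y ∉ Z) (hxy : x ≠ y) (i j : Idx G Z x y t) (e : Sym2 (Finset V))
    (hi : e ∈ EI G Z x y t P i) (hj : e ∈ EI G Z x y t P j) : i = j := by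
  have hZx : ∀ z ∈ Z, z ≠ x := by rintro z hz rfl; exact hx hz
  have hZy : ∀ z ∈ Z, z ≠ y := by rintro z hz rfl; exact hy hz
  have hXY := lab_XY Z x y hx hy hxy
  have noadj : ¬ (cutGraph G Z x y).Adj x y := by simp [cutGraph]
  have DC : ∀ u z, e ∈ EI G Z x y t P (.inl (.inl u)) → e ∈ EI G Z x y t P (.inl (.inr z)) →
      False := by
    rintro u ⟨z, hz⟩ h1 h2
    simp only [EI, Set.mem_singleton_iff, Set.mem_ofPred_eq] at h1 h2
    have hzZ := (Finset.mem_filter.1 hz).1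
    have := hZx z hzZ
    have := hZy z hzZ
    rw [h1, hXY] at h2
    rcases h2 with h2 | h2 <;> have := pair_eq h2 <;> grind
  have DB : ∀ u q, e ∈ EI G Z x y t P (.inl (.inl u)) → e ∈ EI G Z x y t P (.inr (.inl q)) →
      False := by
    rintro u ⟨⟨z, w⟩, hq⟩ h1 h2
    simp only [EI, Set.mem_singleton_iff, Set.mem_ofPred_eq] at h1 h2
    simp only [Finset.mem_sigma, outN, Finset.mem_filter, Finset.mem_univ, true_and] at hq
    obtain ⟨hz, -, hw, hwx, hwy⟩ := hq
    rcases h2 with ⟨h2, -⟩ | h2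
    · rw [h1, hXY] at h2
      have := pair_eq h2; have := hZx z hz; have := hZy z hz; grind
    · rw [h1, Sym2.eq_iff] at h2
      rcases h2 with ⟨h2, -⟩ | ⟨h2, -⟩ <;>
      · have := Finset.ext_iff.1 h2 w
        simp [hw, hwx, hwy] at this
  have DP : ∀ u i, e ∈ EI G Z x y t P (.inl (.inl u)) → e ∈ EI G Z x y t P (.inr (.inr i)) →
      False := by
    intro u i h1 h2
    simp only [EI, Set.mem_singleton_iff] at h1 h2
    rcases EP_lab G Z _ _ x y _ e h2 x y (by rw [h1, hXY]) with h | h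
    · exact hxy h
    · exact noadj h
  have CB : ∀ z q, e ∈ EI G Z x y t P (.inl (.inr z)) → e ∈ EI G Z x y t P (.inr (.inl q)) →
      False := by
    rintro ⟨z', hz'⟩ ⟨⟨z, w⟩, hq⟩ h1 h2
    simp only [EI, Set.mem_ofPred_eq] at h1 h2
    have hzZ := (Finset.mem_filter.1 hz').1
    simp only [Finset.mem_sigma, outN, Finset.mem_filter, Finset.mem_univ, true_and] at hq
    obtain ⟨hz, -, hw, hwx, hwy⟩ := hq
    have := hZx z hz; have := hZy z hz
    have := hZx z' hzZ; have := hZy z' hzZ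
    have h3 : lab e = {z, w} ∨ lab e = {x, y} := by
      rcases h2 with ⟨h2, -⟩ | h2
      · exact Or.inl h2
      · exact Or.inr (by rw [h2, lab_mid Z x y z w hx hy hxy hz hwx hwy])
    rcases h1 with h1 | h1 <;> rcases h3 with h3 | h3 <;> rw [h1] at h3 <;>
      have := pair_eq h3 <;> grind
  have CP : ∀ z i, e ∈ EI G Z x y t P (.inl (.inr z)) → e ∈ EI G Z x y t P (.inr (.inr i)) →
      False := by
    rintro ⟨z, hz⟩ i h1 h2
    simp only [EI, Set.mem_ofPred_eq] at h1 h2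
    have hzZ := (Finset.mem_filter.1 hz).1
    have := hZx z hzZ
    have := hZy z hzZ
    rcases h1 with h1 | h1 <;> rcases EP_lab G Z _ _ x y _ e h2 _ _ h1 with h | h
    · grind
    · simp [cutGraph, hzZ] at h
    · grind
    · simp [cutGraph, hzZ] at h
  have BP : ∀ q i, e ∈ EI G Z x y t P (.inr (.inl q)) → e ∈ EI G Z x y t P (.inr (.inr i)) →
      False := by
    rintro ⟨⟨z, w⟩, hq⟩ i h1 h2
    simp only [EI, Set.mem_ofPred_eq] at h1 h2
    simp only [Finset.mem_sigma, outN, Finset.mem_filter, Finset.mem_univ, true_and] at hq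
    obtain ⟨hz, -, hw, hwx, hwy⟩ := hq
    rcases h1 with ⟨h1, h3⟩ | h1
    · have := h2.2 h3
      rw [h1] at this
      simp [hz] at this
    · rcases EP_lab G Z _ _ x y _ e h2 x y
        (by rw [h1, lab_mid Z x y z w hx hy hxy hz hwx hwy]) with h | h
      · exact hxy h
      · exact noadj h
  rcases i with (i | i) | (i | i) <;> rcases j with (j | j) | (j | j)
  · rfl
  · exact (DC _ _ hi hj).elim
  · exact (DB _ _ hi hj).elim
  · exact (DP _ _ hi hj).elim
  · exact (DC _ _ hj hi).elim
  · obtain ⟨z, hz⟩ := i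
    obtain ⟨z', hz'⟩ := j
    simp only [EI, Set.mem_ofPred_eq] at hi hj
    have h1 := (Finset.mem_filter.1 hz).1
    have h2 := (Finset.mem_filter.1 hz').1
    have := hZx z h1; have := hZy z h1
    have := hZx z' h2; have := hZy z' h2
    have : z = z' := by
      rcases hi with h | h <;> rw [h] at hj <;> rcases hj with h' | h' <;>
        have := pair_eq h' <;> grind
    subst this; rfl
  · exact (CB _ _ hi hj).elim
  · exact (CP _ _ hi hj).elim
  · exact (DB _ _ hj hi).elim
  · exact (CB _ _ hj hi).elim
  · obtain ⟨⟨z, w⟩, hq⟩ := i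
    obtain ⟨⟨z', w'⟩, hq'⟩ := j
    simp only [EI, Set.mem_ofPred_eq] at hi hj
    have hq0 := hq
    have hq0' := hq'
    simp only [Finset.mem_sigma, outN, Finset.mem_filter, Finset.mem_univ, true_and] at hq0 hq0'
    obtain ⟨hz, -, hw, hwx, hwy⟩ := hq0
    obtain ⟨hz', -, hw', hwx', hwy'⟩ := hq0'
    have := hZx z hz; have := hZy z hz
    have := hZx z' hz'; have := hZy z' hz'
    have key : z = z' ∧ w = w' := by
      rcases hi with ⟨h, -⟩ | h
      · rcases hj with ⟨h', -⟩ | h'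
        · rw [h] at h'; have := pair_eq h'; grind
        · rw [h', lab_mid Z x y z' w' hx hy hxy hz' hwx' hwy'] at h
          have := pair_eq h; grind
      · rcases hj with ⟨h', -⟩ | h'
        · rw [h, lab_mid Z x y z w hx hy hxy hz hwx hwy] at h'
          have := pair_eq h'; grind
        · rw [h, Sym2.eq_iff] at h'
          rcases h' with ⟨h', -⟩ | ⟨h', -⟩
          · have e1 := Finset.ext_iff.1 h' w
            have e2 := Finset.ext_iff.1 h' z'
            simp only [Finset.mem_insert, Finset.mem_erase] at e1 e2
            grind
          · have e1 := Finset.ext_iff.1 h' x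
            simp only [Finset.mem_insert, Finset.mem_erase] at e1
            grind
    obtain ⟨rfl, rfl⟩ := key
    rfl
  · exact (BP _ _ hi hj).elim
  · exact (DP _ _ hj hi).elim
  · exact (CP _ _ hj hi).elim
  · exact (BP _ _ hj hi).elim
  · by_contra hij
    have hne : i ≠ j := fun h => hij (by rw [h])
    obtain ⟨⟨f, hf, hl⟩, -⟩ := hi
    obtain ⟨⟨f', hf', hl'⟩, -⟩ := hj
    have : f = f' := by
      apply Sym2.ext; intro s
      rw [← Sym2.mem_toFinset, ← Sym2.mem_toFinset, ← hl, ← hl']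
    subst this
    exact hP i j hne f hf hf'

theorem EI_reach (G : SimpleGraph V) (Z : Finset V) (x y : V) (t : ℕ)
    (P : Fin t → (cutGraph G Z x y).Walk x y)
    (hx : x ∉ Z) (hy : y ∉ Z) (hxy : G.Adj x y) (i : Idx G Z x y t) :
    Relation.ReflTransGen (Stp G (EI G Z x y t P i)) (insert x Z) (insert y Z) := by
  have hne := hxy.ne
  have hZx : ∀ z ∈ Z, z ≠ x := by rintro z hz rfl; exact hx hz
  have hZy : ∀ z ∈ Z, z ≠ y := by rintro z hz rfl; exact hy hz
  rcases i with (i | i) | (i | i)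
  · refine .single ⟨x, y, hxy, by simp, by simp [hy, hne.symm], ?_, by simp [EI]⟩
    rw [Finset.erase_insert hx]
  · obtain ⟨z, hz⟩ := i
    have hz0 := hz
    simp only [Finset.mem_filter] at hz0
    obtain ⟨hzZ, hxz, hzy⟩ := hz0
    have h1 := hZx z hzZ
    have h2 := hZy z hzZ
    have s1 : y ∉ insert x Z := by simp [hy, hne.symm]
    have s2 : z ∈ insert x Z := by simp [hzZ]
    have s3 : x ∈ insert y ((insert x Z).erase z) := by simp [h1.symm]
    have s4 : z ∉ insert y ((insert x Z).erase z) := by simp [h2]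
    have s5 : insert y Z = insert z ((insert y ((insert x Z).erase z)).erase x) := by
      ext s; simp only [Finset.mem_insert, Finset.mem_erase]; grind
    refine .tail (.single (b := insert y ((insert x Z).erase z)) ?_) ?_
    · refine ⟨z, y, hzy, s2, s1, rfl, Or.inl ?_⟩
      rw [lab_mk, symmDiff_move _ _ _ s2 s1]
    · refine ⟨x, z, hxz, s3, s4, s5, Or.inr ?_⟩
      rw [lab_mk, s5, symmDiff_move _ _ _ s3 s4]
  · obtain ⟨⟨z, w⟩, hq⟩ := i
    have hq0 := hq
    simp only [Finset.mem_sigma, outN, Finset.mem_filter, Finset.mem_univ, true_and] at hq0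
    obtain ⟨hzZ, hzw, hw, hwx, hwy⟩ := hq0
    have h1 := hZx z hzZ
    have h2 := hZy z hzZ
    have s1 : z ∈ insert x Z := by simp [hzZ]
    have s2 : w ∉ insert x Z := by simp [hw, hwx]
    have s3 : w ∈ insert w ((insert y Z).erase z) := by simp
    have hzw' : z ≠ w := hzw.ne
    have s4 : z ∉ insert w ((insert y Z).erase z) := by simp [hzw']
    have s5 : insert y Z = insert z ((insert w ((insert y Z).erase z)).erase w) := by
      ext s; simp only [Finset.mem_insert, Finset.mem_erase]; grind
    refine .tail (.tail (.single (b := insert w ((insert x Z).erase z)) ?_)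
      (b := insert w ((insert x Z).erase z)) (c := insert w ((insert y Z).erase z)) ?_) ?_
    · refine ⟨z, w, hzw, s1, s2, rfl, Or.inl ⟨?_, by simp⟩⟩
      rw [lab_mk, symmDiff_move _ _ _ s1 s2]
    · refine ⟨x, y, hxy, ?_, ?_, ?_, Or.inr rfl⟩
      · simp [h1.symm]
      · simp [hwy.symm, hne.symm, hy]
      · ext s; simp only [Finset.mem_insert, Finset.mem_erase]; grind
    · refine ⟨w, z, hzw.symm, s3, s4, s5, Or.inl ⟨?_, by simp⟩⟩
      have := symmDiff_move _ _ _ s3 s4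
      rw [← s5] at this
      rw [lab_mk, this, Finset.pair_comm]
  · refine (token_translate G (cutGraph G Z x y) (fun _ _ h => h.1) Z x y hx hy ?_ ?_
      {f | f ∈ (P i).edges} x y (P i) (fun e he => he) rfl).1 hx
    · intro z hz h; simp [cutGraph, hz] at h
    · intro z hz h; simp [cutGraph, hz] at h

end core

theorem stmt5 [Fintype V] [DecidableEq V] (G : SimpleGraph V) (n k : ℕ)
    (hn : Fintype.card V = n) (h3 : 3 ≤ n) (hG : G.Connected)
    (hk1 : 1 ≤ k) (hkn : k ≤ n - 1) (hkl : k ≤ edgeConn G)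
    (X Y : {s : Finset V // s.card = k}) (hXY : (tokenGraph G k).Adj X Y) :
    ∃ P : Fin (k * (edgeConn G - k + 1)) → (tokenGraph G k).Walk X Y,
      (∀ i, (P i).IsPath) ∧
      ∀ i j, i ≠ j → ∀ e, e ∈ (P i).edges → e ∉ (P j).edges := by
  have hl : EdgeConnected G (edgeConn G) := edgeConnected_edgeConn G (by omega)
  obtain ⟨Z, x, y, hx, hy, hxy, hX, hY⟩ := token_split G k X Y hXY
  have hpaths := cutGraph_paths G (edgeConn G) hl Z x y
  have hk : k = Z.card + 1 := by
    rw [← X.2, hX, Finset.card_insert_of_notMem hx]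
  have hcount := count_le G (edgeConn G) hl Z x y hx (by omega)
  rw [← hk] at hcount
  generalize edgeConn G - 1 - (Z.filter fun z => G.Adj x z ∨ G.Adj z y).card = t at hpaths hcount
  obtain ⟨P, hP⟩ := hpaths
  have hcard : Fintype.card (Idx G Z x y t) =
      1 + (Z.filter fun z => G.Adj x z ∧ G.Adj z y).card + ∑ z ∈ Z, (outN G Z x y z).card + t := by
    simp only [Idx, Fintype.card_sum, Fintype.card_unit, Fintype.card_coe, Finset.card_sigma,
      Fintype.card_fin]
    ring
  have hle : Fintype.card (Fin (k * (edgeConn G - k + 1))) ≤ Fintype.card (Idx G Z x y t) := by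
    rw [hcard, Fintype.card_fin]; exact hcount
  obtain ⟨φ⟩ := Function.Embedding.nonempty_of_card_le hle
  have hw : ∀ i : Idx G Z x y t, ∃ w : (tokenGraph G k).Walk X Y, w.IsPath ∧
      ∀ e ∈ w.edges, e.map Subtype.val ∈ EI G Z x y t P i := by
    intro i
    have hr := EI_reach G Z x y t P hx hy hxy i
    rw [← hX, ← hY] at hr
    obtain ⟨_, w, hw⟩ := reach_walk G k _ _ _ hr X.2
    exact ⟨w.bypass, w.bypass_isPath, fun e he => hw e (w.edges_bypass_subset_edges he)⟩
  choose W hW1 hW2 using hw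
  refine ⟨fun i => W (φ i), fun i => hW1 _, fun i j hij e hi hj => hij ?_⟩
  exact φ.injective (EI_disj G Z x y t P hP hx hy hxy.ne _ _ _ (hW2 _ e hi) (hW2 _ e hj))
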